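/- Simply connected proper subdomains of ℂ are uniformly regular: for every ε > 0 there exists δ > 0 such that every simply connected domain D ⊊ ℂ satisfies Hm_D(z, B(z, ε)) > 1 − ε for all z ∈ D with dist(z, ∂D) < δ. -/

import Mathlib

open MeasureTheory Filter

/-- The complex upper half-plane. -/
def UH : Set ℂ := {z | 0 < z.im}

/-- A planar Brownian motion with sample space `Ω`: a family of probability
measures `P w` (the law of Brownian motion started at `w`), with continuous
paths, Gaussian increments and independent increments. -/
structure PlanarBM (Ω : Type*) [MeasurableSpace Ω] where
  Z : ℝ → Ω → ℂ
  P : ℂ → Measure Ω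
  isProb : ∀ w, IsProbabilityMeasure (P w)
  meas : ∀ t, Measurable (Z t)
  start : ∀ w, ∀ᵐ ω ∂P w, Z 0 ω = w
  contPaths : ∀ w, ∀ᵐ ω ∂P w, Continuous fun t => Z t ω
  incrLaw : ∀ (w : ℂ) (s t : ℝ), 0 ≤ s → s ≤ t →
    (P w).map (fun ω => Z t ω - Z s ω) =
      (((ProbabilityTheory.gaussianReal 0 (Real.toNNReal (t - s))).prod
        (ProbabilityTheory.gaussianReal 0 (Real.toNNReal (t - s)))).map
        fun p : ℝ × ℝ => Complex.equivRealProd.symm p)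
  indepIncr : ∀ (w : ℂ) (s t : ℝ), 0 ≤ s → s ≤ t →
    ProbabilityTheory.IndepFun (fun ω => Z t ω - Z s ω)
      (fun ω => fun u : Set.Iic s => Z u.1 ω) (P w)

/-- First hitting time of the set `A` by the path `f` (∞ if never hit). -/
noncomputable def hitTime (f : ℝ → ℂ) (A : Set ℂ) : ENNReal :=
  sInf (ENNReal.ofReal '' {t : ℝ | 0 ≤ t ∧ f t ∈ A})

/-- First exit time of the path `f` from the set `D`. -/
noncomputable def exitTime (f : ℝ → ℂ) (D : Set ℂ) : ENNReal :=
  hitTime f Dᶜ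

/-- The path `f` exits the domain `D` (in finite time) through the set `B`. -/
def exitsInto (f : ℝ → ℂ) (D B : Set ℂ) : Prop :=
  ∃ t : ℝ, 0 ≤ t ∧ ENNReal.ofReal t = exitTime f D ∧ f t ∈ B

/-- Harmonic measure of `B` in `D` seen from `z`: the probability that Brownian
motion started at `z` exits `D` through `B`. -/
noncomputable def Hm {Ω : Type*} [MeasurableSpace Ω] (BM : PlanarBM Ω)
    (D B : Set ℂ) (z : ℂ) : ENNReal :=
  BM.P z {ω | exitsInto (fun t => BM.Z t ω) D B}

open ProbabilityTheory
open scoped NNReal ENNReal ComplexConjugate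

/-- A simply connected open set that omits `w` cannot contain both a path from a point of a ray
issued from `w` to the opposite ray and the mirror image of this path in the line carrying
these rays. -/
lemma not_path_and_reflection_subset {T : Type*} [TopologicalSpace T] {D : Set ℂ} (hD : IsOpen D)
    [SimplyConnectedSpace D] {w : ℂ} (hw : w ∉ D) {s : Set T} (hs : IsPreconnected s)
    {f : T → ℂ} (hf : ContinuousOn f s) {a b : T} (ha : a ∈ s) (hb : b ∈ s) {e : ℂ}
    (he : ‖e‖ = 1) {r r' : ℝ} (hr : 0 < r) (hr' : 0 < r') (hfa : f a = w + r * e)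
    (hfb : f b = w - r' * e) (hfD : ∀ t ∈ s, f t ∈ D)
    (hgD : ∀ t ∈ s, w + e ^ 2 * conj (f t - w) ∈ D) : False := by
  have : LocallyPathConnectedSpace D := hD.locallyPathConnectedSpace
  have hne : ∀ x : D, (x : ℂ) - w ≠ 0 := fun x h => hw (by
    rw [← sub_eq_zero.1 h]; exact x.2)
  have hee : e * conj e = 1 := by
    rw [Complex.mul_conj, Complex.normSq_eq_norm_sq, he]; simp
  have he0 : e ≠ 0 := by rintro rfl; simp at he
  obtain ⟨L, ⟨-, hL⟩, -⟩ := Complex.isCoveringMapOn_exp.existsUnique_continuousMap_lifts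
    (A := D) (⟨fun x => (x : ℂ) - w, by fun_prop⟩) (a₀ := ⟨f a, hfD a ha⟩)
    (e₀ := Complex.log (f a - w))
    (by simpa using Complex.exp_log (hne ⟨f a, hfD a ha⟩)) (fun x => hne x)
  replace hL : ∀ x : D, Complex.exp (L x) = (x : ℂ) - w := fun x => congrFun hL x
  let F : s → D := fun t => ⟨f t, hfD t t.2⟩
  let G : s → D := fun t => ⟨w + e ^ 2 * conj (f t - w), hgD t t.2⟩
  have hfc : Continuous fun t : s => f t := continuousOn_iff_continuous_domRestrict.1 hf
  have hF : Continuous F := hfc.subtype_mk _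
  have hG : Continuous G := by
    refine Continuous.subtype_mk ?_ _
    exact continuous_const.add (continuous_const.mul (Complex.continuous_conj.comp
      (hfc.sub continuous_const)))
  have : PreconnectedSpace s := Subtype.preconnectedSpace hs
  have key : ∀ t : s, Complex.exp (L (G t) - conj (L (F t))) = e ^ 2 := by
    intro t
    rw [Complex.exp_sub, hL, Complex.exp_conj, hL]
    have : conj (f t - w) ≠ 0 := (map_ne_zero _).2 (hne (F t))
    simp only [F, G]
    field_simp
    ring
  have hconst := Complex.isCoveringMap_exp.const_of_comp (A := s)
    (g := fun t => L (G t) - conj (L (F t)))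
    ((L.continuous.comp hG).sub (Complex.continuous_conj.comp (L.continuous.comp hF)))
    (fun t t' => Subtype.ext (by simp only [key])) ⟨a, ha⟩ ⟨b, hb⟩
  have h2 : ∀ t : s, (∃ ρ : ℝ, f t - w = ρ * e) → G t = F t := by
    rintro t ⟨ρ, hρ⟩
    apply Subtype.ext
    simp only [F, G, hρ, map_mul, Complex.conj_ofReal]
    linear_combination e * ρ * hee - hρ
  have ga := h2 ⟨a, ha⟩ ⟨r, by simp [hfa]⟩
  have gb := h2 ⟨b, hb⟩ ⟨-r', by simp [hfb]⟩
  simp only [ga, gb] at hconst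
  have him : (L (F ⟨a, ha⟩)).im = (L (F ⟨b, hb⟩)).im := by
    have := congrArg Complex.im hconst
    simp only [Complex.sub_im, Complex.conj_im] at this
    linarith
  have ea := hL (F ⟨a, ha⟩)
  have eb := hL (F ⟨b, hb⟩)
  have hdiff : Complex.exp (L (F ⟨a, ha⟩) - L (F ⟨b, hb⟩)) = -(r / r' : ℝ) := by
    have : (r' : ℂ) ≠ 0 := by exact_mod_cast hr'.ne'
    rw [Complex.exp_sub, ea, eb]
    simp only [F, hfa, hfb]
    push_cast
    field_simp
    ring
  have hreal : L (F ⟨a, ha⟩) - L (F ⟨b, hb⟩)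
      = ((L (F ⟨a, ha⟩) - L (F ⟨b, hb⟩)).re : ℂ) := by
    apply Complex.ext <;> simp [him]
  rw [hreal, ← Complex.ofReal_exp, ← Complex.ofReal_neg, Complex.ofReal_inj] at hdiff
  have := Real.exp_pos (L (F ⟨a, ha⟩) - L (F ⟨b, hb⟩)).re
  have := div_pos hr hr'
  linarith

/-- The centred Gaussian law on `ℂ` whose real and imaginary parts are independent of
variance `v`. -/
noncomputable def planarGaussian (v : ℝ≥0) : Measure ℂ :=
  ((gaussianReal 0 v).prod (gaussianReal 0 v)).map
    fun p : ℝ × ℝ => Complex.equivRealProd.symm p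

lemma measurable_equivRealProd_symm :
    Measurable fun p : ℝ × ℝ => Complex.equivRealProd.symm p :=
  Complex.equivRealProdCLM.symm.continuous.measurable

instance (v : ℝ≥0) : IsProbabilityMeasure (planarGaussian v) :=
  Measure.isProbabilityMeasure_map measurable_equivRealProd_symm.aemeasurable

lemma charFun_planarGaussian (v : ℝ≥0) (t : ℂ) :
    charFun (planarGaussian v) t = Complex.exp (-(v * ‖t‖ ^ 2 / 2)) := by
  rw [charFun_apply, planarGaussian, integral_map measurable_equivRealProd_symm.aemeasurable
    (Measurable.aestronglyMeasurable (by fun_prop))]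
  have : ∀ p : ℝ × ℝ, Complex.exp (inner ℝ (Complex.equivRealProd.symm p) t * Complex.I)
      = Complex.exp (t.re * p.1 * Complex.I) * Complex.exp (t.im * p.2 * Complex.I) := by
    intro p
    rw [← Complex.exp_add, Complex.inner]
    congr 1
    simp [Complex.equivRealProd]
    ring
  simp_rw [this]
  rw [integral_prod_mul (fun x : ℝ => Complex.exp (t.re * x * Complex.I))
    (fun x : ℝ => Complex.exp (t.im * x * Complex.I)), ← charFun_apply_real,
    ← charFun_apply_real, charFun_gaussianReal, charFun_gaussianReal, ← Complex.exp_add]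
  congr 1
  have : (‖t‖ : ℂ) ^ 2 = t.re ^ 2 + t.im ^ 2 := by
    rw [← Complex.ofReal_pow, Complex.sq_norm, Complex.normSq_apply]
    push_cast
    ring
  rw [this]
  push_cast
  ring

lemma map_mul_planarGaussian {c : ℂ} {s : ℝ≥0} (hc : ‖c‖ ^ 2 * s = 1) (v : ℝ≥0) :
    (planarGaussian (s * v)).map (fun x => c * x) = planarGaussian v := by
  have : IsProbabilityMeasure ((planarGaussian (s * v)).map (fun x => c * x)) :=
    Measure.isProbabilityMeasure_map (by fun_prop)
  apply Measure.ext_of_charFun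
  ext t
  rw [charFun_apply, integral_map (by fun_prop)
    (Measurable.aestronglyMeasurable (by fun_prop))]
  have : ∀ x : ℂ, inner ℝ (c * x) t = inner ℝ x (conj c * t) := by
    intro x
    simp only [Complex.inner, map_mul]
    congr 1; ring
  simp_rw [this, ← charFun_apply, charFun_planarGaussian]
  congr 2
  have hc' : (‖c‖ : ℂ) ^ 2 * s = 1 := by exact_mod_cast hc
  simp only [norm_mul, RCLike.norm_conj]
  push_cast
  linear_combination ((v : ℂ) * ‖t‖ ^ 2 / 2) * hc'

lemma map_conj_planarGaussian (v : ℝ≥0) :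
    (planarGaussian v).map (fun x => conj x) = planarGaussian v := by
  have hm : Measurable (fun x : ℂ => conj x) := Complex.continuous_conj.measurable
  have : IsProbabilityMeasure ((planarGaussian v).map (fun x => conj x)) :=
    Measure.isProbabilityMeasure_map hm.aemeasurable
  apply Measure.ext_of_charFun
  ext t
  rw [charFun_apply, integral_map hm.aemeasurable
    (Measurable.aestronglyMeasurable (by fun_prop))]
  have : ∀ x : ℂ, inner ℝ (conj x) t = inner ℝ x (conj t) := by
    intro x
    simp [Complex.inner]
  simp_rw [this, ← charFun_apply, charFun_planarGaussian]
  simp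

lemma planarGaussian_rectangle_pos {v : ℝ≥0} (hv : v ≠ 0) {I J : Set ℝ} (hI : IsOpen I)
    (hI' : I.Nonempty) (hJ : IsOpen J) (hJ' : J.Nonempty) :
    0 < planarGaussian v {x | x.re ∈ I ∧ x.im ∈ J} := by
  have hpos : ∀ {K : Set ℝ}, IsOpen K → K.Nonempty → gaussianReal 0 v K ≠ 0 :=
    fun hK hK' h => (hK.measure_pos volume hK').ne' (gaussianReal_absolutelyContinuous' 0 hv h)
  have hm : MeasurableSet {x : ℂ | x.re ∈ I ∧ x.im ∈ J} :=
    (Complex.measurable_re hI.measurableSet).inter (Complex.measurable_im hJ.measurableSet)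
  rw [planarGaussian, Measure.map_apply measurable_equivRealProd_symm hm]
  have : (fun p : ℝ × ℝ => Complex.equivRealProd.symm p) ⁻¹' {x | x.re ∈ I ∧ x.im ∈ J}
      = I ×ˢ J := by
    ext p; simp [Complex.equivRealProd]
  rw [this, Measure.prod_prod]
  exact ENNReal.mul_pos (hpos hI hI') (hpos hJ hJ')

/-- A planar Brownian motion started at the origin. -/
structure IsStdBM {Ω : Type*} [MeasurableSpace Ω] (W : ℝ≥0 → Ω → ℂ) (μ : Measure Ω) : Prop where
  isProb : IsProbabilityMeasure μ
  meas : ∀ t, Measurable (W t)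
  zero : ∀ ω, W 0 ω = 0
  cont : ∀ᵐ ω ∂μ, Continuous fun t => W t ω
  law : ∀ s h, μ.map (fun ω => W (s + h) ω - W s ω) = planarGaussian h
  indep : ∀ s h, IndepFun (fun ω => W (s + h) ω - W s ω) (fun ω (u : Set.Iic s) => W u ω) μ

/-- The values at finitely many times of a function vanishing at `0` are determined by the values
at all but the last time and by the last increment. -/
lemma exists_restrict_insert_eq (I : Finset ℝ≥0) {a : ℝ≥0} (ha : ∀ x ∈ I, x < a) :
    ∃ m h : ℝ≥0, m + h = a ∧ (∀ x ∈ I, x ≤ m) ∧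
      ∃ Φ : (I → ℂ) × ℂ → (↥(insert a I : Finset ℝ≥0) → ℂ), Measurable Φ ∧
        ∀ f : ℝ≥0 → ℂ, f 0 = 0 →
          (insert a I).restrict f = Φ (I.restrict f, f (m + h) - f m) := by
  set m := I.sup id with hm
  have hma : m ≤ a := Finset.sup_le fun x hx => (ha x hx).le
  refine ⟨m, a - m, add_tsub_cancel_of_le hma, fun x hx => Finset.le_sup (f := id) hx,
    fun p u => if h : (u : ℝ≥0) ∈ I then p.1 ⟨u, h⟩ else
      (if hm : m ∈ I then p.1 ⟨m, hm⟩ else 0) + p.2, ?_, ?_⟩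
  · refine measurable_pi_lambda _ fun u => ?_
    split_ifs <;> fun_prop
  · intro f hf
    ext ⟨u, hu⟩
    rw [add_tsub_cancel_of_le hma]
    simp only [Finset.restrict]
    split_ifs with h1 h2
    · rfl
    · rw [(Finset.mem_insert.1 hu).resolve_right h1]; ring
    · have : I = ∅ := by
        by_contra h
        obtain ⟨i, hi, hi'⟩ := Finset.exists_mem_eq_sup I (Finset.nonempty_iff_ne_empty.2 h) id
        exact h2 (by rw [hm, hi']; exact hi)
      have hm0 : m = 0 := by simp [hm, this]
      rw [(Finset.mem_insert.1 hu).resolve_right h1, hm0, hf]; ring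

lemma indepFun_prodMk_of_indepFun_prodMk {Ω E F H : Type*} [MeasurableSpace Ω]
    [MeasurableSpace E] [MeasurableSpace F] [MeasurableSpace H] {μ : Measure Ω}
    [IsProbabilityMeasure μ] {G : Ω → E} {X : Ω → F} {V : Ω → H} (hG : Measurable G)
    (hX : Measurable X) (hV : Measurable V) (hGX : IndepFun G X μ)
    (hV' : IndepFun V (fun ω => (G ω, X ω)) μ) : IndepFun G (fun ω => (X ω, V ω)) μ := by
  have : IsProbabilityMeasure (μ.map G) := Measure.isProbabilityMeasure_map hG.aemeasurable
  have : IsProbabilityMeasure (μ.map X) := Measure.isProbabilityMeasure_map hX.aemeasurable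
  have : IsProbabilityMeasure (μ.map V) := Measure.isProbabilityMeasure_map hV.aemeasurable
  have hXV : IndepFun X V μ := (hV'.comp measurable_id measurable_snd).symm
  rw [indepFun_iff_map_prod_eq_prod_map_map hG.aemeasurable (by fun_prop),
    (indepFun_iff_map_prod_eq_prod_map_map hX.aemeasurable hV.aemeasurable).1 hXV,
    ← (measurePreserving_prodAssoc (μ.map G) (μ.map X) (μ.map V)).map_eq,
    ← (indepFun_iff_map_prod_eq_prod_map_map hG.aemeasurable hX.aemeasurable).1 hGX,
    ← (indepFun_iff_map_prod_eq_prod_map_map (by fun_prop) hV.aemeasurable).1 hV'.symm,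
    Measure.map_map (by fun_prop) (by fun_prop)]
  rfl

namespace IsStdBM

variable {Ω Ω' : Type*} [MeasurableSpace Ω] [MeasurableSpace Ω'] {W : ℝ≥0 → Ω → ℂ}
  {W' : ℝ≥0 → Ω' → ℂ} {μ : Measure Ω} {μ' : Measure Ω'}

lemma measurable_path (hW : IsStdBM W μ) : Measurable fun ω t => W t ω :=
  measurable_pi_lambda _ hW.meas

lemma indepFun_of_indepFun_increments (hW : IsStdBM W μ) {E : Type*} [MeasurableSpace E]
    {G : Ω → E} (hG : Measurable G)
    (h : ∀ s h, IndepFun (fun ω => W (s + h) ω - W s ω)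
      (fun ω => (G ω, fun u : Set.Iic s => W u ω)) μ) :
    IndepFun G (fun ω t => W t ω) μ := by
  have := hW.isProb
  have hm := hW.meas
  refine IndepFun.indepFun_process hG hm fun I => ?_
  change IndepFun G (fun ω => I.restrict (W · ω)) μ
  induction I using Finset.induction_on_max with
  | empty =>
    have : (fun ω => (∅ : Finset ℝ≥0).restrict (W · ω)) = fun _ _ => 0 := by
      ext ω i; exact absurd i.2 (Finset.notMem_empty _)
    rw [this]
    exact indepFun_const_right _ _
  | insert a I ha ih =>
    obtain ⟨m, k, rfl, hIm, Φ, hΦ, hΦ'⟩ := exists_restrict_insert_eq I ha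
    have hrest : (fun ω => (insert (m + k) I).restrict (W · ω))
        = Φ ∘ fun ω => (I.restrict (W · ω), W (m + k) ω - W m ω) := by
      funext ω; exact hΦ' _ (hW.zero ω)
    rw [hrest]
    refine (indepFun_prodMk_of_indepFun_prodMk hG ((Finset.measurable_restrict I).comp
      hW.measurable_path) ((hm _).sub (hm _)) ih ?_).comp measurable_id hΦ
    exact (h m k).comp measurable_id (φ := id)
      (ψ := fun p : E × (Set.Iic m → ℂ) => (p.1, fun i : I => p.2 ⟨i, hIm i i.2⟩)) (by fun_prop)

lemma map_prodMk_increment (hW : IsStdBM W μ) {I : Finset ℝ≥0} {m : ℝ≥0}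
    (hIm : ∀ x ∈ I, x ≤ m) (k : ℝ≥0) :
    μ.map (fun ω => (I.restrict (W · ω), W (m + k) ω - W m ω))
      = (μ.map (fun ω => I.restrict (W · ω))).prod (planarGaussian k) := by
  have := hW.isProb
  have hm := hW.meas
  rw [← hW.law m k]
  refine (indepFun_iff_map_prod_eq_prod_map_map ((Finset.measurable_restrict I).comp
    hW.measurable_path).aemeasurable (by fun_prop)).1 ?_
  exact ((hW.indep m k).comp measurable_id (φ := id)
    (ψ := fun p : Set.Iic m → ℂ => fun i : I => p ⟨i, hIm i i.2⟩) (by fun_prop)).symm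

lemma map_eq (hW : IsStdBM W μ) (hW' : IsStdBM W' μ') :
    μ.map (fun ω t => W t ω) = μ'.map (fun ω t => W' t ω) := by
  have := hW.isProb
  have := hW'.isProb
  have := Measure.isProbabilityMeasure_map (μ := μ) hW.measurable_path.aemeasurable
  have := Measure.isProbabilityMeasure_map (μ := μ') hW'.measurable_path.aemeasurable
  have h1 := isProjectiveLimit_map (X := W) (P := μ) hW.measurable_path.aemeasurable
  have h2 := isProjectiveLimit_map (X := W') (P := μ') hW'.measurable_path.aemeasurable
  refine h1.unique ?_
  convert! h2 using 1
  funext I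
  have hm := hW.meas
  have hm' := hW'.meas
  induction I using Finset.induction_on_max with
  | empty =>
    have h0 : (fun ω => (∅ : Finset ℝ≥0).restrict (W · ω)) = fun _ _ => 0 := by
      ext ω i; exact absurd i.2 (Finset.notMem_empty _)
    have h0' : (fun ω => (∅ : Finset ℝ≥0).restrict (W' · ω)) = fun _ _ => 0 := by
      ext ω i; exact absurd i.2 (Finset.notMem_empty _)
    rw [h0, h0', Measure.map_const, Measure.map_const, measure_univ, measure_univ]
  | insert a I ha ih =>
    obtain ⟨m, k, rfl, hIm, Φ, hΦ, hΦ'⟩ := exists_restrict_insert_eq I ha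
    have hr : Measurable fun ω => (I.restrict (W · ω), W (m + k) ω - W m ω) :=
      ((Finset.measurable_restrict I).comp hW.measurable_path).prodMk ((hm _).sub (hm _))
    have hr' : Measurable fun ω => (I.restrict (W' · ω), W' (m + k) ω - W' m ω) :=
      ((Finset.measurable_restrict I).comp hW'.measurable_path).prodMk ((hm' _).sub (hm' _))
    have e1 : (fun ω => (insert (m + k) I).restrict (W · ω))
        = Φ ∘ fun ω => (I.restrict (W · ω), W (m + k) ω - W m ω) := by
      funext ω; exact hΦ' _ (hW.zero ω)
    have e2 : (fun ω => (insert (m + k) I).restrict (W' · ω))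
        = Φ ∘ fun ω => (I.restrict (W' · ω), W' (m + k) ω - W' m ω) := by
      funext ω; exact hΦ' _ (hW'.zero ω)
    rw [e1, e2, ← Measure.map_map hΦ hr, ← Measure.map_map hΦ hr',
      hW.map_prodMk_increment hIm, hW'.map_prodMk_increment hIm, ih]

lemma const_mul_comp (hW : IsStdBM W μ) {c : ℂ} {s : ℝ≥0} (hc : ‖c‖ ^ 2 * s = 1) :
    IsStdBM (fun u ω => c * W (s * u) ω) μ where
  isProb := hW.isProb
  meas t := (hW.meas _).const_mul c
  zero ω := by simp [hW.zero]
  cont := hW.cont.mono fun ω h => by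
    exact continuous_const.mul (h.comp (by fun_prop : Continuous fun t : ℝ≥0 => s * t))
  law a h := by
    have hm := hW.meas
    rw [← map_mul_planarGaussian hc, ← hW.law (s * a), Measure.map_map (by fun_prop) (by fun_prop)]
    simp only [mul_add, Function.comp_def, mul_sub]
  indep a h := by
    have := (hW.indep (s * a) (s * h)).comp (φ := fun x => c * x)
      (ψ := fun (p : Set.Iic (s * a) → ℂ) (u : Set.Iic a) =>
        c * p ⟨s * u, mul_le_mul_right u.2 s⟩) (by fun_prop) (by fun_prop)
    simpa only [mul_add, Function.comp_def, mul_sub] using this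

lemma star (hW : IsStdBM W μ) : IsStdBM (fun u ω => conj (W u ω)) μ where
  isProb := hW.isProb
  meas t := Complex.continuous_conj.measurable.comp (hW.meas _)
  zero ω := by simp [hW.zero]
  cont := hW.cont.mono fun ω h => Complex.continuous_conj.comp h
  law a h := by
    have hm := hW.meas
    rw [← map_conj_planarGaussian, ← hW.law a,
      Measure.map_map Complex.continuous_conj.measurable (by fun_prop)]
    simp only [Function.comp_def, map_sub]
  indep a h := by
    have := (hW.indep a h).comp (φ := fun x => conj x)
      (ψ := fun (p : Set.Iic a → ℂ) (u : Set.Iic a) => conj (p u))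
      Complex.continuous_conj.measurable
      (measurable_pi_lambda _ fun u => Complex.continuous_conj.measurable.comp
        (measurable_pi_apply u))
    simpa only [Function.comp_def, map_sub] using this

lemma shift (hW : IsStdBM W μ) (t : ℝ≥0) : IsStdBM (fun u ω => W (t + u) ω - W t ω) μ where
  isProb := hW.isProb
  meas u := (hW.meas _).sub (hW.meas _)
  zero ω := by simp
  cont := hW.cont.mono fun ω h =>
    (h.comp (by fun_prop : Continuous fun u : ℝ≥0 => t + u)).sub continuous_const
  law a h := by
    rw [← hW.law (t + a)]
    simp only [add_assoc, sub_sub_sub_cancel_right]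
  indep a h := by
    have := (hW.indep (t + a) h).comp measurable_id (φ := id)
      (ψ := fun (p : Set.Iic (t + a) → ℂ) (u : Set.Iic a) =>
        p ⟨t + u, add_le_add_right u.2 t⟩ - p ⟨t, Set.mem_Iic.2 le_self_add⟩) (by fun_prop)
    simpa only [add_assoc, Function.comp_def, sub_sub_sub_cancel_right, id] using this

lemma indepFun_stopped_shift (hW : IsStdBM W μ) (t : ℝ≥0) :
    IndepFun (fun ω u => W (min u t) ω) (fun ω u => W (t + u) ω - W t ω) μ := by
  refine (hW.shift t).indepFun_of_indepFun_increments
    (measurable_pi_lambda _ fun u => hW.meas _) fun a h => ?_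
  have := (hW.indep (t + a) h).comp measurable_id (φ := id)
    (ψ := fun (p : Set.Iic (t + a) → ℂ) => (fun u : ℝ≥0 =>
        p ⟨min u t, Set.mem_Iic.2 ((min_le_right _ _).trans le_self_add)⟩, fun u : Set.Iic a =>
        p ⟨t + u, add_le_add_right u.2 t⟩ - p ⟨t, Set.mem_Iic.2 le_self_add⟩)) (by fun_prop)
  simpa only [add_assoc, Function.comp_def, sub_sub_sub_cancel_right, id] using this

lemma measureReal_path_eq (hW : IsStdBM W μ) (hW' : IsStdBM W' μ') {S : Set (ℝ≥0 → ℂ)}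
    (hS : MeasurableSet S) :
    μ.real {ω | (fun t => W t ω) ∈ S} = μ'.real {ω | (fun t => W' t ω) ∈ S} := by
  have := congrArg (fun ν => ν.real S) (hW.map_eq hW')
  simp only [map_measureReal_apply hW.measurable_path hS,
    map_measureReal_apply hW'.measurable_path hS] at this
  exact this

end IsStdBM

lemma forall_min_denseSeq_iff {f : ℝ≥0 → ℂ} (hf : Continuous f) {s : ℝ≥0} {A : Set ℂ}
    (hA : IsClosed A) :
    (∀ k, f (min (TopologicalSpace.denseSeq ℝ≥0 k) s) ∈ A) ↔ ∀ t ≤ s, f t ∈ A := by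
  refine ⟨fun h t ht => ?_, fun h k => h _ (min_le_right _ _)⟩
  have hcl : IsClosed {t | f (min t s) ∈ A} :=
    hA.preimage (hf.comp (continuous_id.min continuous_const))
  have := hcl.closure_subset_iff.2 (Set.range_subset_iff.2 h)
    ((TopologicalSpace.denseRange_denseSeq ℝ≥0) t)
  simpa [min_eq_left ht] using this

/-- The functions that stay, during `[0, s]` and up to a null set of discontinuous functions,
in the open set `D`. -/
def staysIn (D : Set ℂ) (s : ℝ≥0) : Set (ℝ≥0 → ℂ) :=
  {f | ∃ n : ℕ, ∀ k, 1 / ((n : ℝ) + 1) ≤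
    Metric.infDist (f (min (TopologicalSpace.denseSeq ℝ≥0 k) s)) Dᶜ}

lemma measurableSet_staysIn (D : Set ℂ) (s : ℝ≥0) : MeasurableSet (staysIn D s) := by
  simp only [staysIn, Set.ofPred_exists, Set.ofPred_forall]
  refine .iUnion fun n => .iInter fun k => measurableSet_le measurable_const ?_
  exact (Metric.continuous_infDist_pt _).measurable.comp (measurable_pi_apply _)

lemma mem_staysIn_iff {D : Set ℂ} (hD : IsOpen D) (hne : Dᶜ.Nonempty) {f : ℝ≥0 → ℂ}
    (hf : Continuous f) {s : ℝ≥0} : f ∈ staysIn D s ↔ ∀ t ≤ s, f t ∈ D := by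
  have hc : ∀ c : ℝ, IsClosed {x | c ≤ Metric.infDist x Dᶜ} := fun c =>
    isClosed_le continuous_const (Metric.continuous_infDist_pt _)
  have hiff := fun c => forall_min_denseSeq_iff hf (s := s) (hc c)
  simp only [Set.mem_ofPred_eq] at hiff
  simp only [staysIn, Set.mem_ofPred_eq, hiff]
  constructor
  · rintro ⟨n, hn⟩ t ht
    by_contra h
    have h1 := hn t ht
    rw [Metric.infDist_zero_of_mem (Set.mem_compl h)] at h1
    have : (0 : ℝ) < 1 / ((n : ℝ) + 1) := by positivity
    linarith
  · intro h
    obtain ⟨t, ht, htmin⟩ := (isCompact_Icc (a := (0 : ℝ≥0)) (b := s)).exists_isMinOn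
      ⟨0, by simp⟩ ((Metric.continuous_infDist_pt Dᶜ).comp hf).continuousOn
    have hpos : 0 < Metric.infDist (f t) Dᶜ :=
      (hD.isClosed_compl.notMem_iff_infDist_pos hne).1 (fun hh => hh (h t ht.2))
    obtain ⟨n, hn⟩ := exists_nat_one_div_lt hpos
    exact ⟨n, fun u hu => hn.le.trans (htmin ⟨zero_le, hu⟩)⟩

/-- The functions bounded by `K` during `[0, s]`, up to a null set of discontinuous functions. -/
def boundedBy (K s : ℝ≥0) : Set (ℝ≥0 → ℂ) :=
  {f | ∀ k, ‖f (min (TopologicalSpace.denseSeq ℝ≥0 k) s)‖ ≤ K}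

lemma measurableSet_boundedBy (K s : ℝ≥0) : MeasurableSet (boundedBy K s) := by
  simp only [boundedBy, Set.ofPred_forall]
  exact .iInter fun k => measurableSet_le (measurable_pi_apply _).norm measurable_const

lemma mem_boundedBy_iff {f : ℝ≥0 → ℂ} (hf : Continuous f) {K s : ℝ≥0} :
    f ∈ boundedBy K s ↔ ∀ t ≤ s, ‖f t‖ ≤ K :=
  forall_min_denseSeq_iff hf (A := {x | ‖x‖ ≤ K}) (isClosed_le continuous_norm continuous_const)

/-- A condition on a function that forces it to cross the half-line `(-∞, -1)` during
`[1/2, 1]`. -/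
def crossing (K : ℝ≥0) : Set (ℝ≥0 → ℂ) :=
  {f | ((f (1 / 2)).re ∈ Set.Iio (-(K + 1) : ℝ) ∧ (f (1 / 2)).im ∈ Set.Ioo (0 : ℝ) 1) ∧
    (f (1 / 2 + 1 / 2) - f (1 / 2)).im < -1 ∧
    (fun u => f (1 / 2 + u) - f (1 / 2)) ∈ boundedBy K 1}

lemma measurableSet_crossing (K : ℝ≥0) : MeasurableSet (crossing K) := by
  have h1 : Measurable fun f : ℝ≥0 → ℂ => f (1 / 2) := measurable_pi_apply _
  have h2 : Measurable fun f : ℝ≥0 → ℂ => f (1 / 2 + 1 / 2) := measurable_pi_apply _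
  refine .inter (.inter ?_ ?_) (.inter ?_ ?_)
  · exact (Complex.measurable_re.comp h1) measurableSet_Iio
  · exact (Complex.measurable_im.comp h1) measurableSet_Ioo
  · exact measurableSet_lt (Complex.measurable_im.comp (h2.sub h1)) measurable_const
  · have : Measurable fun (f : ℝ≥0 → ℂ) (u : ℝ≥0) => f (1 / 2 + u) - f (1 / 2) := by fun_prop
    exact this (measurableSet_boundedBy K 1)

lemma exists_of_mem_crossing {f : ℝ≥0 → ℂ} (hf : Continuous f) {K : ℝ≥0} (h : f ∈ crossing K) :
    ∃ t ≤ 1, ∃ a : ℝ, 1 < a ∧ f t = -a := by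
  obtain ⟨⟨h1, h2⟩, h3, h4⟩ := h
  rw [mem_boundedBy_iff (by fun_prop)] at h4
  have hhalf : (1 / 2 : ℝ≥0) ≤ 1 := by
    rw [← NNReal.coe_le_coe]; norm_num
  have hone : (1 / 2 + 1 / 2 : ℝ≥0) = 1 := add_halves 1
  rw [hone, Complex.sub_im] at h3
  obtain ⟨t, ht, ht0⟩ := intermediate_value_Icc' hhalf
    (f := fun t => (f t).im) (Complex.continuous_im.comp hf).continuousOn
    (show (0 : ℝ) ∈ Set.Icc (f 1).im (f (1 / 2)).im from ⟨by linarith [h2.2], h2.1.le⟩)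
  refine ⟨t, ht.2, -(f t).re, ?_, Complex.ext (by simp) (by simpa using ht0)⟩
  have h5 := h4 (t - 1 / 2) (tsub_le_self.trans ht.2)
  rw [add_tsub_cancel_of_le ht.1] at h5
  have h6 := (Complex.abs_re_le_norm _).trans h5
  rw [Complex.sub_re, abs_le] at h6
  have h7 : (f (1 / 2)).re < -(K + 1) := h1
  linarith [h6.2]

/-- A bound on conditional probabilities integrates, for independent random variables. -/
lemma measure_prodMk_mem_le {Ω α β : Type*} [MeasurableSpace Ω] [MeasurableSpace α]
    [MeasurableSpace β] {μ : Measure Ω} [IsProbabilityMeasure μ] {X : Ω → α} {Y : Ω → β}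
    (hX : Measurable X) (hY : Measurable Y) (hXY : IndepFun X Y μ) {E : Set α} {T : Set (α × β)}
    (hE : MeasurableSet E) (hT : MeasurableSet T) (hTE : ∀ p ∈ T, p.1 ∈ E) {c : ℝ≥0∞}
    (hc : ∀ x ∈ E, μ {ω | (x, Y ω) ∈ T} ≤ c) :
    μ {ω | (X ω, Y ω) ∈ T} ≤ c * μ {ω | X ω ∈ E} := by
  have := Measure.isProbabilityMeasure_map hX.aemeasurable (μ := μ)
  have := Measure.isProbabilityMeasure_map hY.aemeasurable (μ := μ)
  calc μ {ω | (X ω, Y ω) ∈ T} = μ.map (fun ω => (X ω, Y ω)) T :=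
        (Measure.map_apply (hX.prodMk hY) hT).symm
    _ = ∫⁻ x, μ.map Y (Prod.mk x ⁻¹' T) ∂μ.map X := by
        rw [(indepFun_iff_map_prod_eq_prod_map_map hX.aemeasurable hY.aemeasurable).1 hXY,
          Measure.prod_apply hT]
    _ ≤ ∫⁻ x, E.indicator (fun _ => c) x ∂μ.map X := by
        refine lintegral_mono fun x => ?_
        by_cases hx : x ∈ E
        · rw [Set.indicator_of_mem hx, Measure.map_apply hY (measurable_prodMk_left hT)]
          exact hc x hx
        · have : Prod.mk x ⁻¹' T = ∅ := Set.eq_empty_of_forall_notMem fun y hy => hx (hTE _ hy)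
          rw [Set.indicator_of_notMem hx, this, measure_empty]
    _ = c * μ {ω | X ω ∈ E} := by
        rw [lintegral_indicator_const hE, Measure.map_apply hX hE]
        rfl

namespace IsStdBM

variable {Ω : Type*} [MeasurableSpace Ω] {W : ℝ≥0 → Ω → ℂ} {μ : Measure Ω}

lemma exists_measureReal_notMem_boundedBy_lt (hW : IsStdBM W μ) {c : ℝ} (hc : 0 < c) :
    ∃ K : ℝ≥0, μ.real {ω | (fun t => W t ω) ∉ boundedBy K 1} < c := by
  have := hW.isProb
  have hanti : Antitone fun n : ℕ => {ω | (fun t => W t ω) ∉ boundedBy n 1} := by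
    intro m n hmn ω hω hm
    refine hω fun k => (hm k).trans ?_
    exact_mod_cast hmn
  have hlim := tendsto_measure_iInter_atTop (μ := μ)
    (fun n : ℕ => ((measurableSet_boundedBy n 1).preimage
      hW.measurable_path).compl.nullMeasurableSet) hanti ⟨0, measure_ne_top _ _⟩
  have hzero : μ (⋂ n : ℕ, {ω | (fun t => W t ω) ∉ boundedBy n 1}) = 0 := by
    refine measure_mono_null (fun ω hω => ?_) (ae_iff.1 hW.cont)
    intro hcont
    have hω := Set.mem_iInter.1 hω
    obtain ⟨B, hB⟩ := (isCompact_Icc (a := (0 : ℝ≥0)) (b := 1)).exists_bound_of_continuousOn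
      (Continuous.continuousOn hcont)
    obtain ⟨n, hn⟩ := exists_nat_ge B
    refine hω n ((mem_boundedBy_iff hcont).2 fun t ht => ?_)
    exact (hB t ⟨zero_le, ht⟩).trans (by exact_mod_cast hn)
  have hev := hlim.eventually_lt_const
    (show μ (⋂ n : ℕ, {ω | (fun t => W t ω) ∉ boundedBy n 1}) < ENNReal.ofReal c by
      rw [hzero]; simpa)
  obtain ⟨n, hn⟩ := hev.exists
  exact ⟨n, (ENNReal.lt_ofReal_iff_toReal_lt (measure_ne_top _ _)).1 hn⟩

/-- A maximal inequality at all scales. -/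
lemma exists_measureReal_exists_lt_norm_lt (hW : IsStdBM W μ) {c : ℝ} (hc : 0 < c) :
    ∃ K : ℝ≥0, ∀ {μ' : Measure Ω} {W' : ℝ≥0 → Ω → ℂ}, IsStdBM W' μ' → ∀ ρ : ℝ≥0, 0 < ρ →
      μ'.real {ω | ∃ t ≤ ρ ^ 2, K * ρ < ‖W' t ω‖} < c := by
  obtain ⟨K, hK⟩ := hW.exists_measureReal_notMem_boundedBy_lt hc
  refine ⟨K, fun {μ' W'} hW' ρ hρ => ?_⟩
  have := hW'.isProb
  have hρ' : (0 : ℝ) < ρ := hρ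
  have hV := hW'.const_mul_comp (c := ((ρ : ℝ) : ℂ)⁻¹) (s := ρ ^ 2) (by
    simp only [norm_inv, Complex.norm_real, Real.norm_eq_abs, abs_of_pos hρ']
    push_cast
    field_simp)
  refine lt_of_le_of_lt ?_
    ((hW.measureReal_path_eq hV (measurableSet_boundedBy K 1).compl).symm.trans_lt hK)
  refine ENNReal.toReal_mono (measure_ne_top _ _) (measure_mono_ae ?_)
  filter_upwards [hV.cont] with ω hω ⟨t, ht, htK⟩ hb
  have h1 := (mem_boundedBy_iff hω).1 hb (t / ρ ^ 2)
    (div_le_one_of_le₀ ht (zero_le))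
  rw [mul_div_cancel₀ _ (by positivity), norm_mul, norm_inv, Complex.norm_real, Real.norm_eq_abs,
    abs_of_pos hρ', inv_mul_le_iff₀ hρ'] at h1
  linarith

lemma exists_measureReal_crossing_pos (hW : IsStdBM W μ) :
    ∃ K : ℝ≥0, 0 < μ.real {ω | (fun t => W t ω) ∈ crossing K} := by
  have := hW.isProb
  have hhalf : (1 / 2 : ℝ≥0) ≠ 0 := by positivity
  set V : ℝ≥0 → Ω → ℂ := fun u ω => W (1 / 2 + u) ω - W (1 / 2) ω
  have hV : IsStdBM V μ := hW.shift (1 / 2)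
  have hWm := hW.meas
  have hVm := hV.meas
  have hVlaw : μ.map (V (1 / 2)) = planarGaussian (1 / 2) := hW.law _ _
  have hWlaw : μ.map (W (1 / 2)) = planarGaussian (1 / 2) := by
    rw [← hW.law 0 (1 / 2)]; simp [hW.zero]
  have hpos : ∀ {X : Ω → ℂ}, Measurable X → μ.map X = planarGaussian (1 / 2) →
      ∀ {I J : Set ℝ}, IsOpen I → I.Nonempty → IsOpen J → J.Nonempty →
      0 < μ.real {ω | (X ω).re ∈ I ∧ (X ω).im ∈ J} := by
    intro X hX hlaw I J hI hI' hJ hJ'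
    have h := planarGaussian_rectangle_pos hhalf hI hI' hJ hJ'
    have hm : MeasurableSet {x : ℂ | x.re ∈ I ∧ x.im ∈ J} :=
      (Complex.measurable_re hI.measurableSet).inter (Complex.measurable_im hJ.measurableSet)
    rw [← hlaw, Measure.map_apply hX hm] at h
    exact ENNReal.toReal_pos h.ne' (measure_ne_top _ _)
  have hb := hpos (hVm _) hVlaw isOpen_univ Set.univ_nonempty isOpen_Iio ⟨-2, by norm_num⟩
    (J := Set.Iio (-1))
  simp only [Set.mem_univ, true_and, Set.mem_Iio] at hb
  obtain ⟨K, hK⟩ := hV.exists_measureReal_notMem_boundedBy_lt hb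
  refine ⟨K, ?_⟩
  have hA := hpos (hWm _) hWlaw (I := Set.Iio (-(K + 1) : ℝ)) (J := Set.Ioo 0 1) isOpen_Iio
    ⟨-(K + 2), by simp⟩ isOpen_Ioo ⟨1 / 2, by norm_num⟩
  have hR : MeasurableSet {x : ℂ | x.re ∈ Set.Iio (-(K + 1) : ℝ) ∧ x.im ∈ Set.Ioo (0 : ℝ) 1} :=
    (Complex.measurable_re measurableSet_Iio).inter (Complex.measurable_im measurableSet_Ioo)
  have hE : MeasurableSet {f : ℝ≥0 → ℂ | (f (1 / 2)).im < -1 ∧ f ∈ boundedBy K 1} :=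
    (measurableSet_lt (Complex.measurable_im.comp (measurable_pi_apply _))
      measurable_const).inter (measurableSet_boundedBy K 1)
  have hind : IndepFun (W (1 / 2)) (fun ω u => V u ω) μ := by
    have := (hW.indepFun_stopped_shift (1 / 2)).comp
      (measurable_pi_apply (1 / 2 : ℝ≥0)) measurable_id
    simpa only [Function.comp_def, min_self, id] using this
  have hprod := hind.measure_inter_preimage_eq_mul _ _ hR hE
  have hset : {ω | (fun t => W t ω) ∈ crossing K} = W (1 / 2) ⁻¹'
      {x : ℂ | x.re ∈ Set.Iio (-(K + 1) : ℝ) ∧ x.im ∈ Set.Ioo (0 : ℝ) 1} ∩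
      (fun ω u => V u ω) ⁻¹' {f : ℝ≥0 → ℂ | (f (1 / 2)).im < -1 ∧ f ∈ boundedBy K 1} := rfl
  rw [hset, measureReal_def, hprod, ENNReal.toReal_mul]
  refine mul_pos hA ?_
  have hsub : {ω | (V (1 / 2) ω).im < -1} ⊆ (fun ω u => V u ω) ⁻¹'
      {f : ℝ≥0 → ℂ | (f (1 / 2)).im < -1 ∧ f ∈ boundedBy K 1} ∪
      {ω | (fun t => V t ω) ∉ boundedBy K 1} := by
    intro ω hω
    by_cases h : (fun t => V t ω) ∈ boundedBy K 1
    · exact Or.inl ⟨hω, h⟩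
    · exact Or.inr h
  have h1 := (measureReal_mono (μ := μ) hsub).trans (measureReal_union_le _ _)
  rw [measureReal_def μ ((fun ω u => V u ω) ⁻¹' _)] at h1
  linarith

lemma measurableSet_add_mem_staysIn (x : ℂ) (D : Set ℂ) (s : ℝ≥0) :
    MeasurableSet {f : ℝ≥0 → ℂ | (fun t => x + f t) ∈ staysIn D s} := by
  have : Measurable fun (f : ℝ≥0 → ℂ) (t : ℝ≥0) => x + f t := by fun_prop
  exact this (measurableSet_staysIn D s)

/-- If a path from `x` stays in a simply connected domain missing `w` together with its reflection
in the line through `w` and `x`, then it cannot cross that line beyond `w`. -/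
lemma measureReal_add_mem_staysIn_le (hW : IsStdBM W μ) {D : Set ℂ} (hD : IsOpen D)
    [SimplyConnectedSpace D] {w x : ℂ} (hw : w ∉ D) {ρ : ℝ≥0} (hρ : 0 < ρ) (hx : ‖x - w‖ ≤ ρ)
    (K : ℝ≥0) :
    μ.real {ω | (fun t => x + W t ω) ∈ staysIn D (ρ ^ 2)} ≤
      1 - μ.real {ω | (fun t => W t ω) ∈ crossing K} / 2 := by
  have := hW.isProb
  have hne : Dᶜ.Nonempty := ⟨w, hw⟩
  have hρ' : (0 : ℝ) < ρ := hρ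
  have hS := measurableSet_add_mem_staysIn x D (ρ ^ 2)
  have hH1 : μ.real {ω | (fun t => W t ω) ∈ crossing K} ≤ 1 := measureReal_le_one
  rcases eq_or_ne x w with rfl | hxw
  · have h0 : μ {ω | (fun t => x + W t ω) ∈ staysIn D (ρ ^ 2)} = 0 := by
      refine measure_mono_null (fun ω hω => ?_) (ae_iff.1 hW.cont)
      intro hcont
      have : x + W 0 ω ∈ D := (mem_staysIn_iff hD hne (continuous_const.add hcont)).1 hω 0 zero_le
      rw [hW.zero, add_zero] at this
      exact hw this
    rw [measureReal_def, h0, ENNReal.toReal_zero]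
    linarith
  have hr : 0 < ‖x - w‖ := norm_pos_iff.2 (sub_ne_zero.2 hxw)
  set r := ‖x - w‖ with hr_def
  obtain ⟨e, he, hxe⟩ : ∃ e : ℂ, ‖e‖ = 1 ∧ x = w + r * e := by
    refine ⟨(x - w) / r, ?_, ?_⟩
    · rw [norm_div, Complex.norm_real, Real.norm_eq_abs, abs_of_pos hr, ← hr_def, div_self hr.ne']
    · rw [mul_div_cancel₀ _ (by exact_mod_cast hr.ne')]; ring
  have hee : e * conj e = 1 := by
    rw [Complex.mul_conj, Complex.normSq_eq_norm_sq, he]; simp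
  have hW₁ : IsStdBM (fun u ω => e ^ 2 * conj (W u ω)) μ := by
    simpa only [one_mul] using hW.star.const_mul_comp (c := e ^ 2) (s := 1) (by simp [he])
  have hW₂ := hW.const_mul_comp (c := ((ρ : ℝ) : ℂ)⁻¹ * conj e) (s := ρ ^ 2) (by
    simp only [norm_mul, norm_inv, Complex.norm_real, Real.norm_eq_abs, abs_of_pos hρ',
      RCLike.norm_conj, he]
    push_cast
    field_simp)
  have hB := hW.measureReal_path_eq hW₁ hS
  have hH := hW.measureReal_path_eq hW₂ (measurableSet_crossing K)
  simp only [Set.mem_ofPred_eq] at hB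
  set A := {ω | (fun t => x + W t ω) ∈ staysIn D (ρ ^ 2)}
  set B := {ω | (fun t => x + e ^ 2 * conj (W t ω)) ∈ staysIn D (ρ ^ 2)}
  set H := {ω | (fun t => ((ρ : ℝ) : ℂ)⁻¹ * conj e * W (ρ ^ 2 * t) ω) ∈ crossing K}
  have hBm : MeasurableSet B := hW₁.measurable_path hS
  have hHm : MeasurableSet H := hW₂.measurable_path (measurableSet_crossing K)
  have hnull : μ (A ∩ B ∩ H) = 0 := by
    refine measure_mono_null (fun ω hω => ?_) (ae_iff.1 hW.cont)
    intro hcont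
    obtain ⟨⟨hωA, hωB⟩, hωH⟩ := hω
    have hcont₁ : Continuous fun t => e ^ 2 * conj (W t ω) :=
      continuous_const.mul (Complex.continuous_conj.comp hcont)
    have hcont₂ : Continuous fun t => ((ρ : ℝ) : ℂ)⁻¹ * conj e * W (ρ ^ 2 * t) ω :=
      continuous_const.mul (hcont.comp (by fun_prop : Continuous fun t : ℝ≥0 => ρ ^ 2 * t))
    have hA' : ∀ t ≤ ρ ^ 2, x + W t ω ∈ D :=
      (mem_staysIn_iff hD hne (continuous_const.add hcont)).1 hωA
    have hB' : ∀ t ≤ ρ ^ 2, x + e ^ 2 * conj (W t ω) ∈ D :=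
      (mem_staysIn_iff hD hne (continuous_const.add hcont₁)).1 hωB
    obtain ⟨t, ht, a, ha, hta⟩ := exists_of_mem_crossing hcont₂ hωH
    have hτ : ρ ^ 2 * t ≤ ρ ^ 2 := mul_le_of_le_one_right' ht
    have hWτ : W (ρ ^ 2 * t) ω = -(a * ρ * e) := by
      have hρc : ((ρ : ℝ) : ℂ) ≠ 0 := by exact_mod_cast hρ'.ne'
      calc W (ρ ^ 2 * t) ω = ρ * e * (((ρ : ℝ) : ℂ)⁻¹ * conj e * W (ρ ^ 2 * t) ω) := by
            rw [← mul_assoc, mul_mul_mul_comm, mul_inv_cancel₀ hρc, hee, one_mul, one_mul]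
        _ = _ := by rw [hta]; ring
    refine not_path_and_reflection_subset hD hw (isPreconnected_Icc (a := 0) (b := ρ ^ 2 * t))
      (f := fun t => x + W t ω) (continuous_const.add hcont).continuousOn
      (Set.left_mem_Icc.2 zero_le) (Set.right_mem_Icc.2 zero_le) he hr (r' := a * ρ - r) ?_ ?_ ?_
      (fun u hu => hA' u (hu.2.trans hτ)) (fun u hu => ?_)
    · nlinarith
    · simp only [hW.zero, add_zero, hxe]
    · simp only [hWτ, hxe]
      push_cast
      ring
    · convert! hB' u (hu.2.trans hτ) using 1
      have : x - w = r * e := by rw [hxe]; ring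
      simp only [add_sub_right_comm, map_add, this, map_mul, Complex.conj_ofReal]
      linear_combination r * e * hee - hxe
  have h1 := measureReal_union_add_inter (μ := μ) (s := A) hBm
  have h2 : μ.real (A ∩ B) + μ.real H ≤ 1 := by
    have h3 := measureReal_union_add_inter (μ := μ) (s := A ∩ B) hHm
    rw [measureReal_def μ (A ∩ B ∩ H), hnull, ENNReal.toReal_zero, add_zero] at h3
    exact h3 ▸ measureReal_le_one
  have h4 : μ.real (A ∪ B) ≤ 1 := measureReal_le_one
  linarith

lemma measureReal_add_mem_staysIn_add_le (hW : IsStdBM W μ) {D : Set ℂ} (hD : IsOpen D)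
    (hne : Dᶜ.Nonempty) {w : ℂ} {ρ : ℝ≥0} {q : ℝ} (hq0 : 0 ≤ q)
    (hq : ∀ x, ‖x - w‖ ≤ ρ → μ.real {ω | (fun t => x + W t ω) ∈ staysIn D (ρ ^ 2)} ≤ q)
    (z : ℂ) (t : ℝ≥0) :
    μ.real {ω | (fun u => z + W u ω) ∈ staysIn D (t + ρ ^ 2)} ≤
      q * μ.real {ω | (fun u => z + W u ω) ∈ staysIn D t} +
        μ.real {ω | ρ < ‖z + W t ω - w‖} := by
  have := hW.isProb
  have hWm := hW.meas
  have hV := hW.shift t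
  set G : Ω → ℝ≥0 → ℂ := fun ω u => z + W (min u t) ω
  set V : Ω → ℝ≥0 → ℂ := fun ω u => W (t + u) ω - W t ω
  have hGm : Measurable G := measurable_pi_lambda _ fun u => (hWm _).const_add z
  have hVm : Measurable V := hV.measurable_path
  have hind : IndepFun G V μ :=
    (hW.indepFun_stopped_shift t).comp (φ := fun f u => z + f u) (by fun_prop) measurable_id
  set E : Set (ℝ≥0 → ℂ) := {g | g ∈ staysIn D t ∧ ‖g t - w‖ ≤ ρ}
  have hE : MeasurableSet E := by
    have h1 : Measurable fun g : ℝ≥0 → ℂ => ‖g t - w‖ :=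
      ((measurable_pi_apply t).sub measurable_const).norm
    exact (measurableSet_staysIn D t).inter (measurableSet_le h1 measurable_const)
  set T : Set ((ℝ≥0 → ℂ) × (ℝ≥0 → ℂ)) :=
    {p | p.1 ∈ E ∧ (fun u => p.1 t + p.2 u) ∈ staysIn D (ρ ^ 2)}
  have hT : MeasurableSet T := by
    have h1 : Measurable fun (p : (ℝ≥0 → ℂ) × (ℝ≥0 → ℂ)) (u : ℝ≥0) => p.1 t + p.2 u := by
      fun_prop
    exact (measurable_fst hE).inter (h1 (measurableSet_staysIn D _))
  have hGstays : {ω | G ω ∈ staysIn D t} = {ω | (fun u => z + W u ω) ∈ staysIn D t} := by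
    simp only [G, staysIn, Set.mem_ofPred_eq, min_assoc, min_self]
  have hsec : ∀ x, ‖x - w‖ ≤ ρ →
      μ {ω | (fun u => x + V ω u) ∈ staysIn D (ρ ^ 2)} ≤ ENNReal.ofReal q := by
    intro x hx
    have h1 := hV.measureReal_path_eq hW (measurableSet_add_mem_staysIn x D (ρ ^ 2))
    have h2 := h1.trans_le (hq x hx)
    rw [← ofReal_measureReal]
    exact ENNReal.ofReal_le_ofReal h2
  have hTle : μ.real {ω | (G ω, V ω) ∈ T} ≤ q * μ.real {ω | G ω ∈ staysIn D t} := by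
    have h1 : μ {ω | (G ω, V ω) ∈ T} ≤ ENNReal.ofReal q * μ {ω | G ω ∈ staysIn D t} :=
      (measure_prodMk_mem_le hGm hVm hind hE hT (fun p hp => hp.1) fun g hg =>
        (measure_mono fun ω hω => hω.2).trans (hsec (g t) hg.2)).trans
        (mul_le_mul_right (measure_mono fun ω hω => hω.1) _)
    have h2 := ENNReal.toReal_mono (ENNReal.mul_ne_top ENNReal.ofReal_ne_top
      (measure_ne_top _ _)) h1
    rwa [ENNReal.toReal_mul, ENNReal.toReal_ofReal hq0] at h2
  rw [← hGstays]
  suffices hae : {ω | (fun u => z + W u ω) ∈ staysIn D (t + ρ ^ 2)} ≤ᵐ[μ]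
      ({ω | (G ω, V ω) ∈ T} ∪ {ω | ρ < ‖z + W t ω - w‖} : Set Ω) by
    have h1 := ENNReal.toReal_mono (measure_ne_top _ _) (measure_mono_ae hae)
    have h2 := measureReal_union_le (μ := μ) {ω | (G ω, V ω) ∈ T} {ω | ρ < ‖z + W t ω - w‖}
    exact h1.trans (h2.trans (by gcongr))
  filter_upwards [hW.cont] with ω hcont hω
  have hcz : Continuous fun u => z + W u ω := continuous_const.add hcont
  have hstay : ∀ u ≤ t + ρ ^ 2, z + W u ω ∈ D := (mem_staysIn_iff hD hne hcz).1 hω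
  by_cases hle : ‖z + W t ω - w‖ ≤ ρ
  · have h1 : G ω ∈ staysIn D t := by
      have hc : Continuous (G ω) := hcz.comp (by fun_prop : Continuous fun u => min u t)
      exact (mem_staysIn_iff hD hne hc).2 fun u _ =>
        hstay _ ((min_le_right _ _).trans le_self_add)
    have h2 : (fun u => G ω t + V ω u) ∈ staysIn D (ρ ^ 2) := by
      simp only [G, V, min_self, add_assoc, add_sub_cancel]
      have hc : Continuous fun u => z + W (t + u) ω :=
        hcz.comp (by fun_prop : Continuous fun u => t + u)
      exact (mem_staysIn_iff hD hne hc).2 fun u hu => hstay _ (by gcongr)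
    have h3 : ‖G ω t - w‖ ≤ ρ := by simpa only [G, min_self] using hle
    exact Or.inl ⟨⟨h1, h3⟩, h2⟩
  · exact Or.inr (not_le.1 hle)

lemma measureReal_add_mem_staysIn_le_pow (hW : IsStdBM W μ) {D : Set ℂ} (hD : IsOpen D)
    [SimplyConnectedSpace D] {z w : ℂ} (hw : w ∉ D) {δ : ℝ≥0} (hδ : 0 < δ) (hz : ‖z - w‖ ≤ δ)
    {K : ℝ≥0} {c q : ℝ}
    (hK : ∀ ρ : ℝ≥0, 0 < ρ → μ.real {ω | ∃ t ≤ ρ ^ 2, K * ρ < ‖W t ω‖} ≤ c)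
    {K' : ℝ≥0} (hq : 1 - μ.real {ω | (fun t => W t ω) ∈ crossing K'} / 2 = q) (k : ℕ) :
    μ.real {ω | (fun t => z + W t ω) ∈ staysIn D ((δ * (K + 2) ^ k) ^ 2)} ≤ q ^ k + k * c := by
  have := hW.isProb
  have hH0 : 0 ≤ μ.real {ω | (fun t => W t ω) ∈ crossing K'} := measureReal_nonneg
  have hH1 : μ.real {ω | (fun t => W t ω) ∈ crossing K'} ≤ 1 := measureReal_le_one
  have hq0 : 0 ≤ q := by linarith
  have hq1 : q ≤ 1 := by linarith
  have hc : 0 ≤ c := measureReal_nonneg.trans (hK 1 one_pos)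
  induction k with
  | zero => simp
  | succ k ih =>
    set τ := δ * (K + 2) ^ k with hτdef
    have hδτ : δ ≤ τ := le_mul_of_one_le_right' (one_le_pow₀ (by
      exact le_add_left one_le_two))
    have hτ : 0 < τ := hδ.trans_le hδτ
    set ρ := NNReal.sqrt (τ ^ 2 * (K ^ 2 + 4 * K + 3))
    have hρ2 : ρ ^ 2 = τ ^ 2 * (K ^ 2 + 4 * K + 3) := NNReal.sq_sqrt _
    have hρ : τ * (K + 1) ≤ ρ := by
      refine NNReal.le_sqrt_iff_sq_le.2 ?_
      rw [mul_pow]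
      gcongr
      rw [← NNReal.coe_le_coe]
      push_cast
      nlinarith [K.2]
    have hρ0 : 0 < ρ := lt_of_lt_of_le (by positivity) hρ
    have hstep : (δ * (K + 2) ^ (k + 1)) ^ 2 = τ ^ 2 + ρ ^ 2 := by
      rw [hρ2, pow_succ (K + 2), ← mul_assoc, ← hτdef]
      ring
    have h1 := hW.measureReal_add_mem_staysIn_add_le hD ⟨w, hw⟩ hq0
      (fun x hx => hq ▸ hW.measureReal_add_mem_staysIn_le hD hw hρ0 hx K') z (τ ^ 2)
    have h2 : μ.real {ω | ρ < ‖z + W (τ ^ 2) ω - w‖} ≤ c := by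
      refine (measureReal_mono fun ω hω => ?_).trans (hK τ hτ)
      refine ⟨τ ^ 2, le_rfl, ?_⟩
      have h3 : (ρ : ℝ) < ‖z + W (τ ^ 2) ω - w‖ := hω
      have h4 : ‖z + W (τ ^ 2) ω - w‖ ≤ ‖z - w‖ + ‖W (τ ^ 2) ω‖ := by
        rw [add_sub_right_comm]
        exact norm_add_le _ _
      have h5 : (τ * (K + 1) : ℝ) ≤ ρ := by exact_mod_cast hρ
      have h6 : (δ : ℝ) ≤ τ := hδτ
      linarith
    rw [hstep]
    calc _ ≤ q * (q ^ k + k * c) + c := h1.trans (by gcongr)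
      _ ≤ q ^ (k + 1) + (k + 1 : ℕ) * c := by
        have : q * (k * c) ≤ k * c := mul_le_of_le_one_left (by positivity) hq1
        push_cast
        linarith [pow_succ' q k]

lemma exists_forall_measureReal_lt (hW : IsStdBM W μ) {ε : ℝ} (hε : 0 < ε) :
    ∃ δ : ℝ≥0, 0 < δ ∧ ∀ {μ' : Measure Ω} {W' : ℝ≥0 → Ω → ℂ}, IsStdBM W' μ' →
      ∀ {D : Set ℂ}, IsOpen D → SimplyConnectedSpace D → ∀ {z w : ℂ}, w ∉ D → ‖z - w‖ ≤ δ →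
        μ'.real {ω | ¬∃ t, z + W' t ω ∉ D ∧ ∀ s ≤ t, ‖W' s ω‖ < ε} < ε := by
  have := hW.isProb
  obtain ⟨K', hK'⟩ := hW.exists_measureReal_crossing_pos
  have hH1 : μ.real {ω | (fun t => W t ω) ∈ crossing K'} ≤ 1 := measureReal_le_one
  set q := 1 - μ.real {ω | (fun t => W t ω) ∈ crossing K'} / 2
  obtain ⟨N, hN⟩ := exists_pow_lt_of_lt_one (show 0 < ε / 3 by positivity)
    (show q < 1 by simp only [q]; linarith)
  obtain ⟨K₁, hK₁⟩ := hW.exists_measureReal_exists_lt_norm_lt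
    (show 0 < ε / (3 * (N + 1)) by positivity)
  obtain ⟨K₂, hK₂⟩ := hW.exists_measureReal_exists_lt_norm_lt (show 0 < ε / 3 by positivity)
  set δ : ℝ≥0 := ε.toNNReal / ((K₂ + 1) * (K₁ + 2) ^ N)
  have hε' : 0 < ε.toNNReal := Real.toNNReal_pos.2 hε
  have hδ : 0 < δ := by positivity
  refine ⟨δ, hδ, fun {μ' W'} hW' {D} hD hDs {z w} hw hz => ?_⟩
  have := hW'.isProb
  set τ := δ * (K₁ + 2) ^ N with hτdef
  have hτ : τ * (K₂ + 1) = ε.toNNReal := by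
    simp only [τ, δ]
    field_simp
  have hτ0 : 0 < τ := by positivity
  have hτ' : (τ : ℝ) * (K₂ + 1) = ε := by
    rw [← Real.coe_toNNReal ε hε.le, ← hτ]
    push_cast
    rfl
  have h1 := hW'.measureReal_add_mem_staysIn_le_pow hD hw hδ hz (fun ρ hρ => (hK₁ hW' ρ hρ).le)
    (K' := K') (q := q) (by rw [hW'.measureReal_path_eq hW (measurableSet_crossing K')]) N
  rw [← hτdef] at h1
  have h2 := hK₂ hW' τ hτ0
  have h3 : (N : ℝ) * (ε / (3 * (N + 1))) ≤ ε / 3 := by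
    rw [mul_div_assoc', div_le_div_iff₀ (by positivity) (by positivity)]
    nlinarith
  have h4 : μ'.real {ω | ¬∃ t, z + W' t ω ∉ D ∧ ∀ s ≤ t, ‖W' s ω‖ < ε} ≤
      μ'.real {ω | (fun t => z + W' t ω) ∈ staysIn D (τ ^ 2)} +
        μ'.real {ω | ∃ t ≤ τ ^ 2, K₂ * τ < ‖W' t ω‖} := by
    refine le_trans (ENNReal.toReal_mono (measure_ne_top _ _) (measure_mono_ae ?_))
      (measureReal_union_le _ _)
    filter_upwards [hW'.cont] with ω hcont hω
    have hω : ¬∃ t, z + W' t ω ∉ D ∧ ∀ s ≤ t, ‖W' s ω‖ < ε := hω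
    by_contra hnot
    obtain ⟨hn1, hn2⟩ := not_or.1 hnot
    have hn1 : ¬(fun t => z + W' t ω) ∈ staysIn D (τ ^ 2) := hn1
    have hn2 : ¬∃ t ≤ τ ^ 2, K₂ * τ < ‖W' t ω‖ := hn2
    have hcz : Continuous fun t => z + W' t ω := continuous_const.add hcont
    rw [mem_staysIn_iff hD ⟨w, hw⟩ hcz] at hn1
    push Not at hn1 hn2
    obtain ⟨t, ht, htD⟩ := hn1
    refine hω ⟨t, htD, fun s hs => (hn2 s (hs.trans ht)).trans_lt ?_⟩
    have : (0 : ℝ) < τ := hτ0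
    linarith
  linarith

end IsStdBM

lemma PlanarBM.isStdBM {Ω : Type*} [MeasurableSpace Ω] (BM : PlanarBM Ω) (z : ℂ) :
    IsStdBM (fun (u : ℝ≥0) ω => BM.Z u ω - BM.Z 0 ω) (BM.P z) where
  isProb := BM.isProb z
  meas t := (BM.meas _).sub (BM.meas _)
  zero ω := by simp
  cont := by
    filter_upwards [BM.contPaths z] with ω hω
    exact (hω.comp NNReal.continuous_coe).sub continuous_const
  law s h := by
    have := BM.incrLaw z s (s + h) s.2 (by simp)
    simp only [add_sub_cancel_left, Real.toNNReal_coe] at this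
    simp only [sub_sub_sub_cancel_right, NNReal.coe_add]
    exact this
  indep s h := by
    have := (BM.indepIncr z s (s + h) s.2 (by simp)).comp measurable_id (φ := id)
      (ψ := fun (p : Set.Iic (s : ℝ) → ℂ) (u : Set.Iic s) =>
        p ⟨(u : ℝ≥0), Set.mem_Iic.2 (NNReal.coe_le_coe.2 u.2)⟩ - p ⟨0, Set.mem_Iic.2 s.2⟩)
      (by fun_prop)
    simpa only [sub_sub_sub_cancel_right, NNReal.coe_add, Function.comp_def, id] using this

lemma exitsInto_ball {f : ℝ → ℂ} (hf : Continuous f) {D : Set ℂ} (hD : IsOpen D) {ε : ℝ} {t : ℝ}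
    (ht : 0 ≤ t) (htD : f t ∉ D) (hε : ∀ s, 0 ≤ s → s ≤ t → f s ∈ Metric.ball (f 0) ε) :
    exitsInto f D (Metric.ball (f 0) ε) := by
  have hcl : IsClosed {s : ℝ | 0 ≤ s ∧ f s ∈ Dᶜ} :=
    isClosed_Ici.inter (hD.isClosed_compl.preimage hf)
  have hbdd : BddBelow {s : ℝ | 0 ≤ s ∧ f s ∈ Dᶜ} := ⟨0, fun s hs => hs.1⟩
  have hmem := hcl.csInf_mem ⟨t, ht, htD⟩ hbdd
  refine ⟨_, hmem.1, le_antisymm (le_sInf ?_) (sInf_le ⟨_, hmem, rfl⟩),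
    hε _ hmem.1 (csInf_le hbdd ⟨ht, htD⟩)⟩
  rintro _ ⟨s, hs, rfl⟩
  exact ENNReal.ofReal_le_ofReal (csInf_le hbdd hs)

/-- Uniform regularity of simply connected domains: δ can be chosen uniformly
over all simply connected proper subdomains of ℂ. -/
theorem simply_connected_uniformly_regular {Ω : Type*} [MeasurableSpace Ω]
    (BM : PlanarBM Ω) :
    ∀ ε : ℝ, 0 < ε → ∃ δ : ℝ, 0 < δ ∧
      ∀ D : Set ℂ, IsOpen D → D ≠ Set.univ → SimplyConnectedSpace D →
        ∀ z ∈ D, Metric.infDist z (frontier D) < δ →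
          ENNReal.ofReal (1 - ε) < Hm BM D (Metric.ball z ε) z := by
  intro ε hε
  obtain ⟨δ, hδ, h⟩ := (BM.isStdBM 0).exists_forall_measureReal_lt
    (lt_min hε one_pos : 0 < min ε 1)
  refine ⟨δ, hδ, fun D hD hDuniv hDs z hz hdist => ?_⟩
  have := BM.isProb z
  obtain ⟨w, hwD, hw⟩ := (Metric.infDist_lt_iff (nonempty_frontier_iff.2 ⟨⟨z, hz⟩, hDuniv⟩)).1 hdist
  rw [hD.frontier_eq] at hwD
  have hbad := h (BM.isStdBM z) hD hDs hwD.2 (dist_eq_norm z w ▸ hw.le)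
  set S := {ω | exitsInto (fun t => BM.Z t ω) D (Metric.ball z ε)}
  have h1 : 1 ≤ (BM.P z).real S + (BM.P z).real {ω | ¬∃ t : ℝ≥0,
      z + (BM.Z t ω - BM.Z 0 ω) ∉ D ∧ ∀ s ≤ t, ‖BM.Z s ω - BM.Z 0 ω‖ < min ε 1} := by
    refine (probReal_univ (μ := BM.P z)).ge.trans (le_trans (ENNReal.toReal_mono
      (measure_ne_top _ _) (measure_mono_ae ?_)) (measureReal_union_le _ _))
    filter_upwards [BM.contPaths z, BM.start z] with ω hcont hstart _
    by_cases hω : ∃ t : ℝ≥0,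
        z + (BM.Z t ω - BM.Z 0 ω) ∉ D ∧ ∀ s ≤ t, ‖BM.Z s ω - BM.Z 0 ω‖ < min ε 1
    · left
      obtain ⟨t, htD, ht⟩ := hω
      rw [hstart, add_sub_cancel] at htD
      have := exitsInto_ball (ε := ε) hcont hD t.2 htD fun s hs hst => by
        rw [mem_ball_iff_norm]
        exact (ht ⟨s, hs⟩ hst).trans_le (min_le_left _ _)
      rwa [hstart] at this
    · exact Or.inr hω
  have h2 : 0 < (BM.P z).real S := by linarith [min_le_right ε 1]
  calc ENNReal.ofReal (1 - ε) < ENNReal.ofReal ((BM.P z).real S) :=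
        (ENNReal.ofReal_lt_ofReal_iff h2).2 (by linarith [min_le_left ε 1])
    _ = Hm BM D (Metric.ball z ε) z := ofReal_measureReal (measure_ne_top _ _)
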